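/- Let m ≥ 1 and let a be a positive integer. As matrices over the Laurent polynomial ring ℤ[q,q^{−1}], Λ⁻_m(q,a) = q^{am} · Λ⁺_m(q^{−1},a), where Λ⁺_m(q^{−1},a) denotes the matrix Λ⁺_m(q,a) with q replaced by q^{−1} (using that binom(n,k)_{q^{−1}} = q^{−k(n−k)} binom(n,k)_q). -/

import Mathlib

open Polynomial Finset

namespace QHCF

noncomputable section

/-! ### Border strips and P-partitions -/

/-- The full alternating step list: `replicate a₁ b ++ replicate a₂ (!b) ++ ⋯`. -/
def fullSteps : List ℕ → Bool → List Bool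
  | [], _ => []
  | x :: xs, b => List.replicate x b ++ fullSteps xs (!b)

/-- The step sequence of the border strip `𝒢[a₁,…,aₙ]`: `(a₁−1)` up steps (`true`),
then `a₂` right steps (`false`), then `a₃` up steps, alternating, ending with
`(aₙ−1)` final steps. -/
def steps (a : List ℕ) : List Bool := ((fullSteps a true).drop 1).dropLast

/-- The number of boxes `N = a₁+⋯+aₙ−1` of the border strip `𝒢[a₁,…,aₙ]`. -/
def boxCount (a : List ℕ) : ℕ := a.sum - 1

/-- `σ` is a P-partition on `𝒢[a₁,…,aₙ]` with parts at most `m`: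
`σ(t+1) ≤ σ(t)` on up steps and `σ(t) ≤ σ(t+1)` on right steps. -/
def IsPP (m : ℕ) (a : List ℕ) (σ : Fin (boxCount a) → Fin (m + 1)) : Prop :=
  ∀ (t : ℕ) (h : t + 1 < boxCount a),
    if (steps a).getD t true
    then ((σ ⟨t + 1, h⟩ : ℕ) ≤ (σ ⟨t, Nat.lt_of_succ_lt h⟩ : ℕ))
    else ((σ ⟨t, Nat.lt_of_succ_lt h⟩ : ℕ) ≤ (σ ⟨t + 1, h⟩ : ℕ))

/-- The set of P-partitions on `𝒢[a₁,…,aₙ]` with parts at most `m`. -/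
noncomputable def PP (m : ℕ) (a : List ℕ) : Finset (Fin (boxCount a) → Fin (m + 1)) :=
  @Finset.filter _ (IsPP m a) (Classical.decPred _) Finset.univ

/-- The weight of a P-partition: the sum of its parts. -/
def wt {N m : ℕ} (σ : Fin N → Fin (m + 1)) : ℕ := ∑ t, (σ t : ℕ)

/-- The number of P-partitions (parts at most `m`) satisfying a further predicate `p`. -/
noncomputable def PPcount (m : ℕ) (a : List ℕ)
    (p : (Fin (boxCount a) → Fin (m + 1)) → Prop) : ℕ :=
  (@Finset.filter _ p (Classical.decPred _) (PP m a)).card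

/-- The weight generating function `Σ q^{wt σ}` over P-partitions satisfying `p`. -/
noncomputable def PPgen (m : ℕ) (a : List ℕ)
    (p : (Fin (boxCount a) → Fin (m + 1)) → Prop) : Polynomial ℤ :=
  ∑ σ ∈ @Finset.filter _ p (Classical.decPred _) (PP m a), (X : Polynomial ℤ) ^ wt σ

/-- `Ω_m(𝒢,q)`: the weight generating function of all P-partitions with parts at most `m`. -/
noncomputable def Omega (m : ℕ) (a : List ℕ) : Polynomial ℤ := PPgen m a fun _ => True

/-- Generating function over P-partitions with first part `≤ b` and last part `≤ c`. -/
noncomputable def OmegaLE (m : ℕ) (a : List ℕ) (b c : ℕ) : Polynomial ℤ :=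
  PPgen m a fun σ =>
    (∀ h : 0 < boxCount a, (σ ⟨0, h⟩ : ℕ) ≤ b) ∧
    (∀ h : 0 < boxCount a, (σ ⟨boxCount a - 1, Nat.sub_lt h Nat.one_pos⟩ : ℕ) ≤ c)

/-- Generating function over P-partitions with first part `≤ b` and last part `≥ c`. -/
noncomputable def OmegaGE (m : ℕ) (a : List ℕ) (b c : ℕ) : Polynomial ℤ :=
  PPgen m a fun σ =>
    (∀ h : 0 < boxCount a, (σ ⟨0, h⟩ : ℕ) ≤ b) ∧
    (∀ h : 0 < boxCount a, c ≤ (σ ⟨boxCount a - 1, Nat.sub_lt h Nat.one_pos⟩ : ℕ))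

/-! ### Matrices over ℤ -/

/-- `R_m`, the `(m+1)×(m+1)` upper-triangular matrix of ones. -/
def Rmat (m : ℕ) : Matrix (Fin (m + 1)) (Fin (m + 1)) ℤ :=
  Matrix.of fun i j => if i ≤ j then 1 else 0

/-- `W_m`, the antidiagonal permutation matrix (`(W_m)_{ij} = 1` iff `i+j = m+2`, 1-based). -/
def Wmat (m : ℕ) : Matrix (Fin (m + 1)) (Fin (m + 1)) ℤ :=
  Matrix.of fun i j => if (i : ℕ) + 1 + ((j : ℕ) + 1) = m + 2 then 1 else 0

/-- `Λ_m(a) = R_m^a · W_m`. -/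
def Lam (m a : ℕ) : Matrix (Fin (m + 1)) (Fin (m + 1)) ℤ := Rmat m ^ a * Wmat m

/-- The product `Λ_m(a₁)Λ_m(a₂)⋯Λ_m(aₙ)`. -/
def LamProd (m : ℕ) (a : List ℕ) : Matrix (Fin (m + 1)) (Fin (m + 1)) ℤ :=
  (a.map fun x => Lam m x).prod

/-! ### q-deformed matrices over ℤ[q] (with `q = Polynomial.X`) -/

/-- `R_m` as a matrix over `ℤ[q]`. -/
def RmatQ (m : ℕ) : Matrix (Fin (m + 1)) (Fin (m + 1)) (Polynomial ℤ) :=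
  Matrix.of fun i j => if i ≤ j then 1 else 0

/-- `L_m = R_m^⊤` as a matrix over `ℤ[q]`. -/
def LmatQ (m : ℕ) : Matrix (Fin (m + 1)) (Fin (m + 1)) (Polynomial ℤ) := (RmatQ m).transpose

/-- `Q_m = diag(q^m, q^{m-1}, …, q, 1)`. -/
def Qmat (m : ℕ) : Matrix (Fin (m + 1)) (Fin (m + 1)) (Polynomial ℤ) :=
  Matrix.diagonal fun i => X ^ (m - (i : ℕ))

/-- `R_m(q) := R_m · Q_m`. -/
def Rq (m : ℕ) : Matrix (Fin (m + 1)) (Fin (m + 1)) (Polynomial ℤ) := RmatQ m * Qmat m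

/-- `L_m(q) := L_m · Q_m`. -/
def Lq (m : ℕ) : Matrix (Fin (m + 1)) (Fin (m + 1)) (Polynomial ℤ) := LmatQ m * Qmat m

/-- `W_m` as a matrix over `ℤ[q]`. -/
def WmatQ (m : ℕ) : Matrix (Fin (m + 1)) (Fin (m + 1)) (Polynomial ℤ) :=
  Matrix.of fun i j => if (i : ℕ) + 1 + ((j : ℕ) + 1) = m + 2 then 1 else 0

/-- `Λ⁺_m(q,a) := R_m(q)^a · W_m`. -/
def LamP (m a : ℕ) : Matrix (Fin (m + 1)) (Fin (m + 1)) (Polynomial ℤ) := Rq m ^ a * WmatQ m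

/-- `Λ⁻_m(q,a) := W_m · L_m(q)^a`. -/
def LamM (m a : ℕ) : Matrix (Fin (m + 1)) (Fin (m + 1)) (Polynomial ℤ) := WmatQ m * Lq m ^ a

/-- Alternating product of `Λ⁺`/`Λ⁻` matrices (`b = true` starts with `Λ⁺`). -/
def altLam (m : ℕ) : List ℕ → Bool → Matrix (Fin (m + 1)) (Fin (m + 1)) (Polynomial ℤ)
  | [], _ => 1
  | x :: xs, b => (if b then LamP m x else LamM m x) * altLam m xs (!b)

/-- `X_𝒢(q) = Λ⁺_m(q,a₁)Λ⁻_m(q,a₂)Λ⁺_m(q,a₃)⋯`. -/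
def XG (m : ℕ) (a : List ℕ) : Matrix (Fin (m + 1)) (Fin (m + 1)) (Polynomial ℤ) :=
  altLam m a true

/-- Alternating product of powers of `R_m(q)` and `L_m(q)` (`b = true` starts with `R`). -/
def altRL (m : ℕ) : List ℕ → Bool → Matrix (Fin (m + 1)) (Fin (m + 1)) (Polynomial ℤ)
  | [], _ => 1
  | x :: xs, b => (if b then Rq m ^ x else Lq m ^ x) * altRL m xs (!b)

/-- `R_m(q)^{a₁} L_m(q)^{a₂} R_m(q)^{a₃} ⋯`. -/
def RLProd (m : ℕ) (a : List ℕ) : Matrix (Fin (m + 1)) (Fin (m + 1)) (Polynomial ℤ) :=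
  altRL m a true

/-! ### Gaussian binomial coefficients -/

/-- The Gaussian binomial coefficient `binom(n,k)_q ∈ ℤ[q]`, defined via the
q-Pascal recursion `binom(n,k)_q = binom(n−1,k−1)_q + q^k·binom(n−1,k)_q`;
it equals `[n]_q!/([k]_q![n−k]_q!)`. -/
def qbinom : ℕ → ℕ → Polynomial ℤ
  | _, 0 => 1
  | 0, _ + 1 => 0
  | n + 1, k + 1 => qbinom n k + X ^ (k + 1) * qbinom n (k + 1)

/-- The q-multichoose coefficient `mbinom(n,k)_q := binom(n+k−1,k)_q`. -/
def qmbinom (n k : ℕ) : Polynomial ℤ := qbinom (n + k - 1) k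

/-! ### Higher q-continued fractions -/

/-- The higher q-continued fraction
`r^q_{i,m}(a₁,…,aₙ) := Ω_m^{m+1−i,1}(𝒢,q) · (Ω_m^{m+1,1}(𝒢,q))⁻¹ ∈ ℤ⟦q⟧`,
i.e. the generating function over P-partitions with first part `≤ i`, divided by the
one over P-partitions with first part `= 0` (whose constant term is `1`). -/
noncomputable def rq (m i : ℕ) (a : List ℕ) : PowerSeries ℤ :=
  (↑(OmegaLE m a i m) : PowerSeries ℤ) *
    PowerSeries.invOfUnit (↑(OmegaLE m a 0 m) : PowerSeries ℤ) 1

/-- The value `v(a₁,…,aₙ)` of a finite continued fraction `a₁ + 1/(a₂ + 1/(⋯))`. -/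
def cfVal : List ℕ → ℚ
  | [] => 1
  | [x] => (x : ℚ)
  | x :: y :: xs => (x : ℚ) + 1 / cfVal (y :: xs)

end

end QHCF

open QHCF

theorem WmatQ_apply_eq_ite (m : ℕ) (i j : Fin (m + 1)) :
    WmatQ m i j = if j = i.rev then 1 else 0 := by
  simp only [WmatQ, Matrix.of_apply, Fin.ext_iff, Fin.val_rev]
  congr 1
  apply propext
  omega

theorem WmatQ_mul_apply (m : ℕ) (A : Matrix (Fin (m + 1)) (Fin (m + 1)) (Polynomial ℤ))
    (i j : Fin (m + 1)) : (WmatQ m * A) i j = A i.rev j := by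
  simp [Matrix.mul_apply, WmatQ_apply_eq_ite]

theorem mul_WmatQ_apply (m : ℕ) (A : Matrix (Fin (m + 1)) (Fin (m + 1)) (Polynomial ℤ))
    (i j : Fin (m + 1)) : (A * WmatQ m) i j = A i j.rev := by
  have h (k : Fin (m + 1)) : j = k.rev ↔ k = j.rev := by rw [eq_comm, Fin.rev_eq_iff]
  simp [Matrix.mul_apply, WmatQ_apply_eq_ite, h]

theorem Rq_apply (m : ℕ) (i j : Fin (m + 1)) :
    Rq m i j = if i ≤ j then X ^ (m - (j : ℕ)) else 0 := by
  simp [Rq, RmatQ, Qmat, Matrix.mul_diagonal]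

theorem Lq_apply (m : ℕ) (i j : Fin (m + 1)) :
    Lq m i j = if j ≤ i then X ^ (m - (j : ℕ)) else 0 := by
  simp [Lq, LmatQ, RmatQ, Qmat, Matrix.mul_diagonal]

/-- A ring homomorphism out of `ℤ[q]` does not affect the 0-1 matrix `W_m`. -/
theorem map_WmatQ {S : Type*} [Ring S] (m : ℕ) (f g : Polynomial ℤ →+* S) :
    (WmatQ m).map f = (WmatQ m).map g := by
  ext i j
  simp only [Matrix.map_apply, WmatQ_apply_eq_ite]
  split_ifs <;> simp

/-- The substitution `q ↦ q⁻¹`, as a ring homomorphism `ℤ[q] → ℤ[q,q⁻¹]`. -/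
noncomputable def evalInv : Polynomial ℤ →+* LaurentPolynomial ℤ :=
  (Polynomial.aeval (LaurentPolynomial.T (-1) : LaurentPolynomial ℤ)).toRingHom

theorem evalInv_X_pow (n : ℕ) : evalInv (X ^ n) = LaurentPolynomial.T (-(n : ℤ)) := by
  simp [evalInv, LaurentPolynomial.T_pow]

/-- `W_m · L_m(q) = q^m · R_m(q⁻¹) · W_m`. -/
theorem semiconjBy_WmatQ (m : ℕ) :
    SemiconjBy ((WmatQ m).map Polynomial.toLaurent) ((Lq m).map Polynomial.toLaurent)
      ((LaurentPolynomial.T (m : ℤ) : LaurentPolynomial ℤ) • (Rq m).map evalInv) := by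
  rw [SemiconjBy, Matrix.smul_mul, map_WmatQ m Polynomial.toLaurent evalInv, ← Matrix.map_mul,
    map_WmatQ m evalInv Polynomial.toLaurent, ← Matrix.map_mul]
  ext1 i j
  rw [Matrix.smul_apply, Matrix.map_apply, Matrix.map_apply, WmatQ_mul_apply, mul_WmatQ_apply,
    Lq_apply, Rq_apply]
  simp only [Fin.le_rev_iff (i := j)]
  split_ifs
  · rw [evalInv_X_pow, Polynomial.toLaurent_X_pow, smul_eq_mul, ← LaurentPolynomial.T_add]
    congr 1
    rw [Fin.val_rev]
    omega
  · simp

/-- As matrices over `ℤ[q,q⁻¹]`, `Λ⁻_m(q,a) = q^{am}·Λ⁺_m(q⁻¹,a)`,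
where `q ↦ q⁻¹` is realized by the algebra map `ℤ[q] → ℤ[q,q⁻¹]` sending `X` to `T(−1)`. -/
theorem statement7 (m a : ℕ) (hm : 1 ≤ m) (ha : 1 ≤ a) :
    (LamM m a).map Polynomial.toLaurent =
      (LaurentPolynomial.T ((a : ℤ) * (m : ℤ)) : LaurentPolynomial ℤ) •
        (LamP m a).map (fun p =>
          (Polynomial.aeval (LaurentPolynomial.T (-1) : LaurentPolynomial ℤ) p :
            LaurentPolynomial ℤ)) := by
  have key := ((semiconjBy_WmatQ m).pow_right a).eq
  rw [_root_.smul_pow, LaurentPolynomial.T_pow, Matrix.smul_mul, ← Matrix.map_pow, ← Matrix.map_pow,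
    ← Matrix.map_mul, map_WmatQ m Polynomial.toLaurent evalInv, ← Matrix.map_mul] at key
  exact key
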